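/- Let 0 < γ ≤ 1/2000 and let H be a 3-graph on n vertices (n sufficiently large in terms of γ) such that, for some integer t with 1 ≤ t ≤ (1 − √(2/3))·n, the degree sequence d₁ ≤ … ≤ dₙ of H satisfies dᵢ ≥ (1/3 + γ)·C(n,2) for 1 ≤ i ≤ t, dᵢ ≥ (4/9 + γ)·C(n,2) for t < i ≤ n/3, and dᵢ ≥ (5/9)·C(n,2) for i > n/3. Then for every 3-element set T ⊆ V(H) containing at least two vertices of degree at least (5/9)·C(n,2), there are at least (γ³/400)·C(n,2)³ absorbing sets for T. -/

import Mathlib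

open Finset
open scoped Classical

noncomputable section

/-- The degree of a vertex `v` in a `3`-graph `H` on `Fin n`. -/
def deg {n : ℕ} (H : Finset (Finset (Fin n))) (v : Fin n) : ℕ :=
  (H.filter fun e => v ∈ e).card

/-- `H` is a `3`-graph: every edge has exactly three vertices. -/
def Is3Graph (n : ℕ) (H : Finset (Finset (Fin n))) : Prop :=
  ∀ e ∈ H, e.card = 3

/-- `M` is a matching in `H`. -/
def IsMatching {n : ℕ} (H M : Finset (Finset (Fin n))) : Prop :=
  M ⊆ H ∧ ∀ e ∈ M, ∀ f ∈ M, e ≠ f → Disjoint e f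

/-- The set of vertices covered by a collection `M` of edges. -/
def cover {n : ℕ} (M : Finset (Finset (Fin n))) : Finset (Fin n) :=
  M.biUnion id

/-- `σ` witnesses the degree sequence condition of the absorbing lemma:
`σ` is a monotone-degree ordering of the vertices and, writing `dᵢ = deg (σ i)`
(1-based positions), `dᵢ ≥ (1/3 + γ)·C(n,2)` for `1 ≤ i ≤ t`,
`dᵢ ≥ (4/9 + γ)·C(n,2)` for `t < i ≤ n/3`, and `dᵢ ≥ (5/9)·C(n,2)` for `i > n/3`. -/
def DegSeqAbs {n : ℕ} (γ : ℝ) (t : ℕ) (H : Finset (Finset (Fin n)))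
    (σ : Fin n ≃ Fin n) : Prop :=
  Monotone (fun i => deg H (σ i)) ∧
  ∀ i : Fin n,
    ((i : ℕ) + 1 ≤ t →
      ((1 : ℝ)/3 + γ) * (n.choose 2) ≤ (deg H (σ i) : ℝ)) ∧
    (t < (i : ℕ) + 1 → 3 * ((i : ℕ) + 1) ≤ n →
      ((4 : ℝ)/9 + γ) * (n.choose 2) ≤ (deg H (σ i) : ℝ)) ∧
    (n < 3 * ((i : ℕ) + 1) →
      ((5 : ℝ)/9) * (n.choose 2) ≤ (deg H (σ i) : ℝ))

/-- `A` is an absorbing set for `T`: `A` is a `6`-element set disjoint from `T` such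
that the induced sub-`3`-graph `H[A]` contains a matching of size two and `H[A ∪ T]`
contains a matching of size three. -/
def IsAbsorbingSet {n : ℕ} (H : Finset (Finset (Fin n))) (T A : Finset (Fin n)) : Prop :=
  A.card = 6 ∧ Disjoint A T ∧
  (∃ M, IsMatching H M ∧ M.card = 2 ∧ ∀ e ∈ M, e ⊆ A) ∧
  (∃ M, IsMatching H M ∧ M.card = 3 ∧ ∀ e ∈ M, e ⊆ A ∪ T)

/-- The link of `v`: the pairs that together with `v` form an edge of `H`. -/
def link {n : ℕ} (H : Finset (Finset (Fin n))) (v : Fin n) : Finset (Finset (Fin n)) :=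
  (univ.powersetCard 2).filter fun p => insert v p ∈ H

lemma deg_le_card_link {n : ℕ} {H : Finset (Finset (Fin n))} (hH : Is3Graph n H) (v : Fin n) :
    deg H v ≤ (link H v).card := by
  refine Finset.card_le_card_of_injOn (fun e => e.erase v) ?_ ?_
  · intro e he
    have he' := Finset.mem_filter.1 (Finset.mem_coe.1 he)
    simp only [link, Finset.coe_filter, Set.mem_ofPred_eq, Finset.mem_powersetCard]
    refine ⟨⟨Finset.subset_univ _, ?_⟩, ?_⟩
    · rw [Finset.card_erase_of_mem he'.2, hH e he'.1]
    · rw [Finset.insert_erase he'.2]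
      exact he'.1
  · intro e he f hf hef
    have he' := Finset.mem_filter.1 (Finset.mem_coe.1 he)
    have hf' := Finset.mem_filter.1 (Finset.mem_coe.1 hf)
    have hef' : e.erase v = f.erase v := hef
    rw [← Finset.insert_erase he'.2, hef', Finset.insert_erase hf'.2]

lemma card_add_card_le_card_inter_add_choose {n k : ℕ} {X Y : Finset (Finset (Fin n))}
    (hX : X ⊆ univ.powersetCard k) (hY : Y ⊆ univ.powersetCard k) :
    X.card + Y.card ≤ (X ∩ Y).card + n.choose k := by
  have h := Finset.card_union_add_card_inter X Y
  have h2 := Finset.card_le_card (Finset.union_subset hX hY)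
  rw [Finset.card_powersetCard, Finset.card_univ, Fintype.card_fin] at h2
  omega

lemma card_le_card_filter_disjoint_add {n : ℕ} {X : Finset (Finset (Fin n))}
    (hX : X ⊆ univ.powersetCard 2) (W : Finset (Fin n)) :
    X.card ≤ (X.filter fun p => Disjoint p W).card + W.card * n := by
  have h := Finset.card_filter_add_card_filter_not (s := X) (fun p => Disjoint p W)
  have h2 : (X.filter fun p => ¬ Disjoint p W).card ≤ W.card * n := by
    have hsub : (X.filter fun p => ¬ Disjoint p W) ⊆
        (W ×ˢ (univ : Finset (Fin n))).image fun a => {a.1, a.2} := by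
      intro p hp
      obtain ⟨hpX, hp⟩ := Finset.mem_filter.1 hp
      obtain ⟨a, hap, haW⟩ := Finset.not_disjoint_iff.1 hp
      have hc := (Finset.mem_powersetCard.1 (hX hpX)).2
      obtain ⟨b, hb⟩ : ∃ b, p.erase a = {b} := by
        rw [← Finset.card_eq_one, Finset.card_erase_of_mem hap, hc]
      refine Finset.mem_image.2 ⟨(a, b), by simp [haW], ?_⟩
      change insert a {b} = p
      rw [← hb, Finset.insert_erase hap]
    calc _ ≤ _ := Finset.card_le_card hsub
      _ ≤ _ := Finset.card_image_le
      _ = W.card * n := by simp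
  omega

lemma IsMatching.pair {n : ℕ} {H : Finset (Finset (Fin n))} {e f : Finset (Fin n)}
    (he : e ∈ H) (hf : f ∈ H) (hef : Disjoint e f) : IsMatching H {e, f} := by
  refine ⟨by simp [Finset.insert_subset_iff, he, hf], ?_⟩
  simp only [Finset.mem_insert, Finset.mem_singleton]
  rintro a (rfl | rfl) b (rfl | rfl) hab
  · exact absurd rfl hab
  · exact hef
  · exact hef.symm
  · exact absurd rfl hab

lemma IsMatching.triple {n : ℕ} {H : Finset (Finset (Fin n))} {e f g : Finset (Fin n)}
    (he : e ∈ H) (hf : f ∈ H) (hg : g ∈ H) (hef : Disjoint e f) (heg : Disjoint e g)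
    (hfg : Disjoint f g) : IsMatching H {e, f, g} := by
  refine ⟨by simp [Finset.insert_subset_iff, he, hf, hg], ?_⟩
  simp only [Finset.mem_insert, Finset.mem_singleton]
  rintro a (rfl | rfl | rfl) b (rfl | rfl | rfl) hab <;>
    first
    | exact absurd rfl hab
    | assumption
    | exact Disjoint.symm (by assumption)

lemma isAbsorbingSet_union {n : ℕ} {H : Finset (Finset (Fin n))} {x y z u w : Fin n}
    {q r : Finset (Fin n)} (hxy : x ≠ y) (hxz : x ≠ z) (hyz : y ≠ z) (huw : u ≠ w)
    (hq : q.card = 2) (hr : r.card = 2)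
    (hp : Disjoint ({u, w} : Finset (Fin n)) {x, y, z})
    (hqd : Disjoint q ({x, y, z} ∪ {u, w})) (hrd : Disjoint r ({x, y, z} ∪ {u, w} ∪ q))
    (hxp : insert x {u, w} ∈ H) (huq : insert u q ∈ H) (hyq : insert y q ∈ H)
    (hwr : insert w r ∈ H) (hzr : insert z r ∈ H) :
    IsAbsorbingSet H {x, y, z} ({u, w} ∪ q ∪ r) := by
  have key : ∀ {e f : Finset (Fin n)} {v : Fin n}, Disjoint (insert v e) f →
      insert v e ≠ f := by
    intro e f v h h'
    rw [← h', Finset.disjoint_self_iff_empty] at h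
    exact Finset.insert_ne_empty _ _ h
  obtain ⟨hqT, hqp⟩ := Finset.disjoint_union_right.1 hqd
  obtain ⟨hrTp, hrq⟩ := Finset.disjoint_union_right.1 hrd
  obtain ⟨hrT, hrp⟩ := Finset.disjoint_union_right.1 hrTp
  have hcard : ({u, w} ∪ q ∪ r).card = 6 := by
    rw [Finset.card_union_of_disjoint (Finset.disjoint_union_left.2 ⟨hrp.symm, hrq.symm⟩),
      Finset.card_union_of_disjoint hqp.symm, Finset.card_pair huw, hq, hr]
  have hdisj : Disjoint ({u, w} ∪ q ∪ r) {x, y, z} :=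
    Finset.disjoint_union_left.2 ⟨Finset.disjoint_union_left.2 ⟨hp, hqT⟩, hrT⟩
  simp only [Finset.disjoint_insert_right, Finset.disjoint_singleton_right, Finset.mem_insert,
    Finset.mem_singleton, not_or] at hp hqT hqp hrT hrp
  have d1 : Disjoint (insert u q) (insert w r) := by
    simp only [Finset.disjoint_insert_right, Finset.disjoint_insert_left, Finset.mem_insert, not_or]
    exact ⟨⟨huw.symm, hqp.2⟩, hrp.1, hrq.symm⟩
  have d2 : Disjoint (insert y q) (insert z r) := by
    simp only [Finset.disjoint_insert_right, Finset.disjoint_insert_left, Finset.mem_insert, not_or]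
    exact ⟨⟨hyz.symm, hqT.2.2⟩, hrT.2.1, hrq.symm⟩
  have d3 : Disjoint (insert y q) (insert x {u, w}) := by
    simp only [Finset.disjoint_insert_right, Finset.mem_insert, Finset.disjoint_singleton_right,
      not_or]
    exact ⟨⟨hxy, hqT.1⟩, ⟨Ne.symm hp.2.1.1, hqp.1⟩, Ne.symm hp.2.1.2, hqp.2⟩
  have d4 : Disjoint (insert z r) (insert x {u, w}) := by
    simp only [Finset.disjoint_insert_right, Finset.mem_insert, Finset.disjoint_singleton_right,
      not_or]
    exact ⟨⟨hxz, hrT.1⟩, ⟨Ne.symm hp.2.2.1, hrp.1⟩, Ne.symm hp.2.2.2, hrp.2⟩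
  refine ⟨hcard, hdisj, ⟨{insert u q, insert w r}, IsMatching.pair huq hwr d1,
    Finset.card_pair (key d1), ?_⟩, ⟨{insert y q, insert z r, insert x {u, w}},
    IsMatching.triple hyq hzr hxp d2 d3 d4,
    Finset.card_eq_three.2 ⟨_, _, _, key d2, key d3, key d4, rfl⟩, ?_⟩⟩
  · simp only [Finset.mem_insert, Finset.mem_singleton]
    rintro e (rfl | rfl) <;> refine Finset.insert_subset (by simp) fun a ha => by simp [ha]
  · simp only [Finset.mem_insert, Finset.mem_singleton]
    rintro e (rfl | rfl | rfl) <;> refine Finset.insert_subset (by simp) fun a ha => ?_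
    · simp [ha]
    · simp [ha]
    · exact Finset.mem_union_left _ (Finset.mem_union_left _ (Finset.mem_union_left _ ha))

/-- Counting six-element sets built as unions of three pairs chosen one after another: each set
arises from at most `15 ^ 2` choices. -/
lemma pow_three_le_card_of_pairs {α : Type*} [DecidableEq α] {F P : Finset (Finset α)} {c : ℝ} (hc : 0 ≤ c)
    (hF : ∀ A ∈ F, A.card = 6) (hP : c ≤ P.card)
    (h : ∀ p ∈ P, ∃ Q : Finset (Finset α), c ≤ Q.card ∧
      ∀ q ∈ Q, ∃ R : Finset (Finset α), c ≤ R.card ∧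
        ∀ r ∈ R, p.card = 2 ∧ q.card = 2 ∧ Disjoint r (p ∪ q) ∧ p ∪ q ∪ r ∈ F) :
    c ^ 3 ≤ 225 * F.card := by
  choose! Q hQ using h
  have h2 : ∀ p q, p ∈ P ∧ q ∈ Q p → ∃ R : Finset (Finset α), c ≤ R.card ∧
      ∀ r ∈ R, p.card = 2 ∧ q.card = 2 ∧ Disjoint r (p ∪ q) ∧ p ∪ q ∪ r ∈ F :=
    fun p q hpq => (hQ p hpq.1).2 q hpq.2
  choose! R hR using h2
  let X : Finset (Σ _ : Finset α, Σ _ : Finset α, Finset α) :=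
    P.sigma fun p => (Q p).sigma fun q => R p q
  have hX : c ^ 3 ≤ X.card := by
    have hin : ∀ p ∈ P, c * c ≤ (((Q p).sigma fun q => R p q).card : ℝ) := by
      intro p hp
      rw [Finset.card_sigma, Nat.cast_sum]
      calc c * c ≤ (Q p).card * c := by gcongr; exact (hQ p hp).1
        _ = ∑ _q ∈ Q p, c := by simp
        _ ≤ _ := Finset.sum_le_sum fun q hq => (hR p q ⟨hp, hq⟩).1
    rw [Finset.card_sigma, Nat.cast_sum]
    calc c ^ 3 = c * (c * c) := by ring
      _ ≤ P.card * (c * c) := by gcongr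
      _ = ∑ _p ∈ P, c * c := by simp
      _ ≤ _ := Finset.sum_le_sum hin
  have hXmem : ∀ a ∈ X, a.1.card = 2 ∧ a.2.1.card = 2 ∧ Disjoint a.2.2 (a.1 ∪ a.2.1) ∧
      a.1 ∪ a.2.1 ∪ a.2.2 ∈ F := by
    rintro ⟨p, q, r⟩ ha
    simp only [X, Finset.mem_sigma] at ha
    exact (hR p q ⟨ha.1, ha.2.1⟩).2 r ha.2.2
  have hcard : X.card ≤ 225 * F.card := by
    refine Finset.card_le_mul_card_image_of_maps_to (f := fun a => a.1 ∪ a.2.1 ∪ a.2.2)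
      (fun a ha => (hXmem a ha).2.2.2) 225 fun A hA => ?_
    have hpc : (A.powersetCard 2 ×ˢ A.powersetCard 2).card = 225 := by
      rw [Finset.card_product, Finset.card_powersetCard, hF A hA]
      rfl
    rw [← hpc]
    refine Finset.card_le_card_of_injOn (fun a => (a.1, a.2.1)) ?_ ?_
    · intro a ha
      obtain ⟨ha, haA⟩ := Finset.mem_filter.1 (Finset.mem_coe.1 ha)
      have hm := hXmem a ha
      simp only [Finset.coe_product, Set.mem_prod, Finset.mem_coe, Finset.mem_powersetCard]
      refine ⟨⟨?_, hm.1⟩, ?_, hm.2.1⟩ <;> rw [← haA] <;> intro v hv <;> simp [hv]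
    · rintro ⟨p, q, r⟩ ha ⟨p', q', r'⟩ hb hab
      obtain ⟨ha, haA⟩ := Finset.mem_filter.1 (Finset.mem_coe.1 ha)
      obtain ⟨hb, hbA⟩ := Finset.mem_filter.1 (Finset.mem_coe.1 hb)
      obtain ⟨rfl, rfl⟩ : p = p' ∧ q = q' := by simpa using hab
      have hr : Disjoint r (p ∪ q) := (hXmem _ ha).2.2.1
      have hr' : Disjoint r' (p ∪ q) := (hXmem _ hb).2.2.1
      have hrr : r = r' := by
        rw [← Finset.union_sdiff_cancel_left hr.symm, ← Finset.union_sdiff_cancel_left hr'.symm]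
        exact congrArg (· \ (p ∪ q)) (haA.trans hbA.symm)
      rw [hrr]
  calc c ^ 3 ≤ X.card := hX
    _ ≤ ((225 * F.card : ℕ) : ℝ) := by exact_mod_cast hcard
    _ = 225 * F.card := by push_cast; ring

/-- Many pairs outside `W` lie in the links of both `u` and `v`, when `u` and `v` have large
degree sum. -/
lemma le_card_inter_link_filter_disjoint {n : ℕ} {H : Finset (Finset (Fin n))}
    (hH : Is3Graph n H) {γ : ℝ} {u v : Fin n}
    (h : (1 + γ) * (n.choose 2) ≤ (deg H u : ℝ) + deg H v) (W : Finset (Fin n)) :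
    γ * (n.choose 2) - W.card * n ≤
      (((link H u ∩ link H v).filter fun p => Disjoint p W).card : ℝ) := by
  have h1 := deg_le_card_link hH u
  have h2 := deg_le_card_link hH v
  have h3 : (link H u).card + (link H v).card ≤ (link H u ∩ link H v).card + n.choose 2 :=
    card_add_card_le_card_inter_add_choose (Finset.filter_subset _ _) (Finset.filter_subset _ _)
  have h4 := card_le_card_filter_disjoint_add (X := link H u ∩ link H v)
    (Finset.inter_subset_left.trans (Finset.filter_subset _ _)) W
  have h5 : (deg H u : ℝ) + deg H v ≤
      (((link H u ∩ link H v).filter fun p => Disjoint p W).card : ℝ) + W.card * n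
        + n.choose 2 := by
    exact_mod_cast (by omega)
  linarith

/-- Many pairs of the link of `x` avoid both a small set `S` and a set `W`. -/
lemma le_card_link_filter_disjoint {n : ℕ} {H : Finset (Finset (Fin n))}
    (hH : Is3Graph n H) {γ : ℝ} {x : Fin n} (h : (1 / 3 + γ) * (n.choose 2) ≤ (deg H x : ℝ))
    {S : Finset (Fin n)} (hS : (S.card : ℝ) ≤ (1 - Real.sqrt (2 / 3)) * n)
    (W : Finset (Fin n)) :
    γ * (n.choose 2) - (W.card + 1) * n ≤
      (((link H x ∩ powersetCard 2 Sᶜ).filter fun p => Disjoint p W).card : ℝ) := by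
  have h1 := deg_le_card_link hH x
  have h3 : (link H x).card + (powersetCard 2 Sᶜ).card ≤
      (link H x ∩ powersetCard 2 Sᶜ).card + n.choose 2 :=
    card_add_card_le_card_inter_add_choose (Finset.filter_subset _ _)
      (Finset.powersetCard_mono (Finset.subset_univ _))
  have h4 := card_le_card_filter_disjoint_add (X := link H x ∩ powersetCard 2 Sᶜ)
    (Finset.inter_subset_left.trans (Finset.filter_subset _ _)) W
  have hSn : S.card ≤ n := by simpa using Finset.card_le_univ S
  rw [Finset.card_powersetCard, Finset.card_compl, Fintype.card_fin] at h3
  have h5 : (deg H x : ℝ) + ((n - S.card).choose 2 : ℕ) ≤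
      (((link H x ∩ powersetCard 2 Sᶜ).filter fun p => Disjoint p W).card : ℝ) + W.card * n
        + n.choose 2 := by
    exact_mod_cast (by omega)
  have h6 : (2 / 3 : ℝ) * n.choose 2 - n ≤ ((n - S.card).choose 2 : ℕ) := by
    rw [Nat.cast_choose_two, Nat.cast_choose_two, Nat.cast_sub hSn]
    have hs : Real.sqrt (2 / 3) ^ 2 = 2 / 3 := Real.sq_sqrt (by norm_num)
    have hm : Real.sqrt (2 / 3) * n ≤ (n : ℝ) - S.card := by linarith
    have hm2 : (Real.sqrt (2 / 3) * n) ^ 2 ≤ ((n : ℝ) - S.card) ^ 2 :=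
      pow_le_pow_left₀ (by positivity) hm 2
    rw [mul_pow, hs] at hm2
    have hS0 : (0 : ℝ) ≤ S.card := by positivity
    have hn0 : (0 : ℝ) ≤ n := by positivity
    nlinarith
  linarith

lemma DegSeqAbs.one_third_le_deg {n t : ℕ} {γ : ℝ} {H : Finset (Finset (Fin n))}
    {σ : Fin n ≃ Fin n} (h : DegSeqAbs γ t H σ) (hγ : γ ≤ 1 / 9) (v : Fin n) :
    (1 / 3 + γ) * (n.choose 2) ≤ (deg H v : ℝ) := by
  have hv := h.2 (σ.symm v)
  rw [Equiv.apply_symm_apply] at hv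
  have hC : (0 : ℝ) ≤ n.choose 2 := by positivity
  by_cases h1 : (σ.symm v : ℕ) + 1 ≤ t
  · exact hv.1 h1
  · by_cases h2 : 3 * ((σ.symm v : ℕ) + 1) ≤ n
    · refine le_trans ?_ (hv.2.1 (by omega) h2)
      exact mul_le_mul_of_nonneg_right (by linarith) hC
    · refine le_trans ?_ (hv.2.2 (by omega))
      gcongr; linarith

lemma DegSeqAbs.four_ninths_le_deg {n t : ℕ} {γ : ℝ} {H : Finset (Finset (Fin n))}
    {σ : Fin n ≃ Fin n} (h : DegSeqAbs γ t H σ) (hγ : γ ≤ 1 / 9) {v : Fin n}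
    (hvt : t < (σ.symm v : ℕ) + 1) :
    (4 / 9 + γ) * (n.choose 2) ≤ (deg H v : ℝ) := by
  have hv := h.2 (σ.symm v)
  rw [Equiv.apply_symm_apply] at hv
  have hC : (0 : ℝ) ≤ n.choose 2 := by positivity
  by_cases h2 : 3 * ((σ.symm v : ℕ) + 1) ≤ n
  · exact hv.2.1 hvt h2
  · refine le_trans ?_ (hv.2.2 (by omega))
    gcongr; linarith

/-- Claim: for `0 < γ ≤ 1/2000` and `n` sufficiently large, if `H` is a `3`-graph on
`n` vertices satisfying the degree sequence condition `DegSeqAbs` for some `t` with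
`1 ≤ t ≤ (1 − √(2/3))·n`, then every `3`-element set `T ⊆ V(H)` containing at least
two vertices of degree at least `(5/9)·C(n,2)` has at least `(γ³/400)·C(n,2)³`
absorbing sets. -/
theorem many_absorbing_sets (γ : ℝ) (hγ : 0 < γ) (hγ' : γ ≤ 1/2000) :
    ∃ n₀ : ℕ, ∀ n : ℕ, n₀ ≤ n →
      ∀ t : ℕ, 1 ≤ t → (t : ℝ) ≤ (1 - Real.sqrt (2/3)) * n →
      ∀ H : Finset (Finset (Fin n)), Is3Graph n H →
      (∃ σ : Fin n ≃ Fin n, DegSeqAbs γ t H σ) →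
      ∀ T : Finset (Fin n), T.card = 3 →
        2 ≤ (T.filter fun v => ((5 : ℝ)/9) * (n.choose 2) ≤ (deg H v : ℝ)).card →
        γ^3 / 400 * ((n.choose 2 : ℝ))^3 ≤
          (((univ.powersetCard 6).filter fun A => IsAbsorbingSet H T A).card : ℝ) := by
  refine ⟨⌈200 / γ⌉₊ + 1, fun n hn t _ htn H hH hσ T hT hT2 => ?_⟩
  obtain ⟨σ, hσ⟩ := hσ
  obtain ⟨y, hy, z, hz, hyz⟩ := Finset.one_lt_card.1 hT2
  obtain ⟨hyT, hy⟩ := Finset.mem_filter.1 hy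
  obtain ⟨hzT, hz⟩ := Finset.mem_filter.1 hz
  obtain ⟨x, hxy, hxz, rfl⟩ : ∃ x, x ≠ y ∧ x ≠ z ∧ T = {x, y, z} := by
    have hsub : ({y, z} : Finset (Fin n)) ⊆ T := by simp [Finset.insert_subset_iff, hyT, hzT]
    have hc : (T \ {y, z}).card = 1 := by
      rw [Finset.card_sdiff_of_subset hsub, hT, Finset.card_pair hyz]
    obtain ⟨x, hx⟩ := Finset.card_eq_one.1 hc
    have hxm : x ∈ T \ {y, z} := by simp [hx]
    simp only [Finset.mem_sdiff, Finset.mem_insert, Finset.mem_singleton, not_or] at hxm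
    refine ⟨x, hxm.2.1, hxm.2.2, ?_⟩
    rw [← Finset.sdiff_union_of_subset hsub, hx]
    rfl
  have hγ9 : γ ≤ 1 / 9 := by linarith
  set C : ℝ := (n.choose 2 : ℝ) with hCdef
  have hC0 : 0 ≤ C := by positivity
  have hlarge : 10 * (n : ℝ) ≤ γ / 10 * C := by
    have h1 : 200 / γ ≤ (n : ℝ) - 1 := by
      have h2 : ((⌈200 / γ⌉₊ + 1 : ℕ) : ℝ) ≤ n := by exact_mod_cast hn
      push_cast at h2
      linarith [Nat.le_ceil (200 / γ)]
    rw [div_le_iff₀ hγ] at h1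
    rw [hCdef, Nat.cast_choose_two]
    have hn0 : (0 : ℝ) ≤ n := by positivity
    nlinarith
  have hn0 : (0 : ℝ) ≤ n := by positivity
  let S : Finset (Fin n) := univ.filter fun v => (σ.symm v : ℕ) + 1 ≤ t
  have hScard : S.card ≤ t := by
    have := Finset.card_le_card_of_injOn (s := S) (t := range t) (fun v => (σ.symm v : ℕ))
      (fun v hv => by
        have := (Finset.mem_filter.1 (Finset.mem_coe.1 hv)).2
        simp only [Finset.coe_range, Set.mem_Iio]
        omega)
      (fun v _ w _ hvw => σ.symm.injective (Fin.ext hvw))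
    simpa using this
  have hS : (S.card : ℝ) ≤ (1 - Real.sqrt (2 / 3)) * n :=
    le_trans (by exact_mod_cast hScard) htn
  have hSdeg : ∀ v ∉ S, (4 / 9 + γ) * C ≤ (deg H v : ℝ) := by
    intro v hv
    refine hσ.four_ninths_le_deg hγ9 ?_
    simpa [S] using hv
  have hTc : (({x, y, z} : Finset (Fin n)).card : ℝ) = 3 := by rw [hT]; norm_num
  have hcount := pow_three_le_card_of_pairs (c := 9 / 10 * (γ * C))
    (F := (univ.powersetCard 6).filter fun A => IsAbsorbingSet H {x, y, z} A)
    (P := (link H x ∩ powersetCard 2 Sᶜ).filter fun p => Disjoint p {x, y, z}) (by positivity)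
    (fun A hA => (Finset.mem_powersetCard.1 (Finset.mem_filter.1 hA).1).2) ?_ ?_
  · nlinarith [pow_nonneg (mul_nonneg hγ.le hC0) 3]
  · have := le_card_link_filter_disjoint hH (hσ.one_third_le_deg hγ9 x) hS {x, y, z}
    rw [hTc] at this
    linarith
  intro p hp
  obtain ⟨hp, hpT⟩ := Finset.mem_filter.1 hp
  obtain ⟨hpx, hpS⟩ := Finset.mem_inter.1 hp
  obtain ⟨hpS, hp2⟩ := Finset.mem_powersetCard.1 hpS
  have hpx := (Finset.mem_filter.1 hpx).2
  obtain ⟨u, w, huw, rfl⟩ := Finset.card_eq_two.1 hp2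
  have hu := hSdeg u (Finset.mem_compl.1 (hpS (by simp)))
  have hw := hSdeg w (Finset.mem_compl.1 (hpS (by simp)))
  have hW : (({x, y, z} ∪ {u, w} : Finset (Fin n)).card : ℝ) ≤ 5 := by
    have := Finset.card_union_le ({x, y, z} : Finset (Fin n)) {u, w}
    rw [hT, hp2] at this
    exact_mod_cast this
  refine ⟨(link H u ∩ link H y).filter fun q => Disjoint q ({x, y, z} ∪ {u, w}), ?_, ?_⟩
  · have := le_card_inter_link_filter_disjoint hH (γ := γ) (u := u) (v := y)
      (by linarith) ({x, y, z} ∪ {u, w})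
    nlinarith
  intro q hq
  obtain ⟨hq, hqT⟩ := Finset.mem_filter.1 hq
  obtain ⟨hqu, hqy⟩ := Finset.mem_inter.1 hq
  obtain ⟨hq2, hqu⟩ := Finset.mem_filter.1 hqu
  have hq2 := (Finset.mem_powersetCard.1 hq2).2
  have hqy := (Finset.mem_filter.1 hqy).2
  refine ⟨(link H w ∩ link H z).filter fun r => Disjoint r ({x, y, z} ∪ {u, w} ∪ q), ?_, ?_⟩
  · have := le_card_inter_link_filter_disjoint hH (γ := γ) (u := w) (v := z)
      (by linarith) ({x, y, z} ∪ {u, w} ∪ q)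
    have hW' : (({x, y, z} ∪ {u, w} ∪ q : Finset (Fin n)).card : ℝ) ≤ 7 := by
      have h7 : (({x, y, z} ∪ {u, w} ∪ q : Finset (Fin n)).card : ℝ) ≤
          ({x, y, z} ∪ {u, w} : Finset (Fin n)).card + q.card := by
        exact_mod_cast Finset.card_union_le ({x, y, z} ∪ {u, w} : Finset (Fin n)) q
      rw [hq2] at h7
      push_cast at h7
      linarith
    nlinarith
  intro r hr
  obtain ⟨hr, hrT⟩ := Finset.mem_filter.1 hr
  obtain ⟨hrw, hrz⟩ := Finset.mem_inter.1 hr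
  obtain ⟨hr2, hrw⟩ := Finset.mem_filter.1 hrw
  have hr2 := (Finset.mem_powersetCard.1 hr2).2
  have hrz := (Finset.mem_filter.1 hrz).2
  have habs := isAbsorbingSet_union hxy hxz hyz huw hq2 hr2 hpT hqT hrT hpx hqu hqy hrw hrz
  refine ⟨hp2, hq2, hrT.mono_right ?_, Finset.mem_filter.2
    ⟨Finset.mem_powersetCard.2 ⟨Finset.subset_univ _, habs.1⟩, habs⟩⟩
  exact Finset.union_subset_union_left (Finset.subset_union_right (s₁ := {x, y, z}))
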